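/- arXiv:1402.3666 — 8 statements merged into one kernel-verified Lean document; each statement's English description precedes it below -/
import Mathlib

section
/- Let K be a number field and σ : K → K a ℚ-algebra automorphism such that ρ(σ(a)) = conj(ρ(a)) for every ring embedding ρ : K → ℂ and every a ∈ K. Then the trace pairing (a,b) ↦ Tr_{K/ℚ}(a·σ(b)) is a symmetric, positive definite ℚ-bilinear form on K: Tr_{K/ℚ}(a·σ(b)) = Tr_{K/ℚ}(b·σ(a)) for all a,b ∈ K, and Tr_{K/ℚ}(a·σ(a)) > 0 for every nonzero a ∈ K. -/
/-- For a number field `K` with a ℚ-algebra automorphism `σ` such that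
`ρ (σ a) = conj (ρ a)` for every embedding `ρ : K → ℂ`, the trace pairing
`(a, b) ↦ Tr_{K/ℚ} (a * σ b)` is symmetric and positive definite. -/
theorem trace_pairing_symm_posdef (K : Type*) [Field K] [NumberField K]
    (σ : K ≃ₐ[ℚ] K)
    (hσ : ∀ (ρ : K →+* ℂ) (a : K), ρ (σ a) = (starRingEnd ℂ) (ρ a)) :
    (∀ a b : K, Algebra.trace ℚ K (a * σ b) = Algebra.trace ℚ K (b * σ a)) ∧
    (∀ a : K, a ≠ 0 → 0 < Algebra.trace ℚ K (a * σ a)) := by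
  have hinv (a : K) : σ (σ a) = a := by
    obtain ⟨ρ⟩ : Nonempty (K →+* ℂ) := inferInstance
    apply ρ.injective
    rw [hσ, hσ, Complex.conj_conj]
  refine ⟨fun a b => ?_, fun a ha => ?_⟩
  · rw [← Algebra.trace_eq_of_algEquiv σ (a * σ b), map_mul, hinv, mul_comm]
  · have htrace : ((Algebra.trace ℚ K (a * σ a) : ℚ) : ℂ) =
        ((∑ ρ : K →ₐ[ℚ] ℂ, Complex.normSq (ρ a) : ℝ) : ℂ) := by
      rw [← eq_ratCast (algebraMap ℚ ℂ), trace_eq_sum_embeddings ℂ, Complex.ofReal_sum]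
      refine Finset.sum_congr rfl fun ρ _ => ?_
      rw [map_mul, ← Complex.mul_conj]
      exact congrArg (ρ a * ·) (hσ ρ.toRingHom a)
    have hreal : ((Algebra.trace ℚ K (a * σ a) : ℚ) : ℝ) =
        ∑ ρ : K →ₐ[ℚ] ℂ, Complex.normSq (ρ a) := by
      exact_mod_cast htrace
    have hpos : (0 : ℝ) < ∑ ρ : K →ₐ[ℚ] ℂ, Complex.normSq (ρ a) :=
      Finset.sum_pos (fun ρ _ => Complex.normSq_pos.mpr ((map_ne_zero ρ).mpr ha))
        ⟨IsAlgClosed.lift, Finset.mem_univ _⟩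
    rw [← hreal] at hpos
    exact_mod_cast hpos
end

section
/- Let K be a number field and σ : K → K a ℚ-algebra automorphism such that ρ(σ(a)) = conj(ρ(a)) for every ring embedding ρ : K → ℂ. Let V be a finite-dimensional ℚ-vector space with a K-module structure, and let W ⊆ V_ℂ be a ℂ-subspace stable under a ⊗ 1 for every a ∈ K. Suppose there exists a symmetric positive definite ℚ-bilinear form B on V such that W is isotropic for B_ℂ. Then there exists a symmetric positive definite ℚ-bilinear form B₂ on V such that W is isotropic for (B₂)_ℂ and B₂(a•x, y) = B₂(x, σ(a)•y) for all a ∈ K and x, y ∈ V. -/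
open TensorProduct

/-- The action of `a ∈ K` on `ℂ ⊗[ℚ] V`, i.e. `a ⊗ 1`. -/
noncomputable def actionC (K V : Type*) [Field K] [Algebra ℚ K] [AddCommGroup V]
    [Module ℚ V] [Module K V] [IsScalarTower ℚ K V] (a : K) :
    (ℂ ⊗[ℚ] V) →ₗ[ℂ] (ℂ ⊗[ℚ] V) :=
  LinearMap.baseChange ℂ ((LinearMap.lsmul K V a).restrictScalars ℚ)

/-- The form `(a, b) ↦ Tr (a * σ b)` on `K`. -/
noncomputable def twistedTraceForm (K : Type*) [Field K] [NumberField K] (σ : K ≃ₐ[ℚ] K) :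
    LinearMap.BilinForm ℚ K :=
  (Algebra.traceForm ℚ K).compl₂ σ.toLinearMap

section TwistedTraceForm

variable {K : Type*} [Field K] [NumberField K] {σ : K ≃ₐ[ℚ] K}

theorem twistedTraceForm_apply (a b : K) :
    twistedTraceForm K σ a b = Algebra.trace ℚ K (a * σ b) := rfl

theorem involutive_of_forall_embedding_conj
    (hσ : ∀ (ρ : K →+* ℂ) (a : K), ρ (σ a) = (starRingEnd ℂ) (ρ a)) (a : K) :
    σ (σ a) = a := by
  obtain ⟨ρ⟩ : Nonempty (K →+* ℂ) := inferInstance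
  apply ρ.injective
  rw [hσ, hσ, Complex.conj_conj]

theorem twistedTraceForm_mul_left (hσ : ∀ a, σ (σ a) = a) (a b c : K) :
    twistedTraceForm K σ (a * b) c = twistedTraceForm K σ (σ a * c) b := by
  rw [twistedTraceForm_apply, twistedTraceForm_apply,
    ← Algebra.trace_eq_of_algEquiv σ (a * b * σ c)]
  simp only [map_mul, hσ]
  congr 1
  ring

theorem twistedTraceForm_comm (hσ : ∀ a, σ (σ a) = a) (a b : K) :
    twistedTraceForm K σ a b = twistedTraceForm K σ b a := by
  simpa using twistedTraceForm_mul_left hσ 1 a b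

theorem twistedTraceForm_self_pos
    (hσ : ∀ (ρ : K →+* ℂ) (a : K), ρ (σ a) = (starRingEnd ℂ) (ρ a)) {a : K} (ha : a ≠ 0) :
    0 < twistedTraceForm K σ a a := by
  have h : ((twistedTraceForm K σ a a : ℚ) : ℂ) =
      ((∑ ρ : K →ₐ[ℚ] ℂ, Complex.normSq (ρ a) : ℝ) : ℂ) := by
    rw [twistedTraceForm_apply, ← eq_ratCast (algebraMap ℚ ℂ), trace_eq_sum_embeddings ℂ,
      Complex.ofReal_sum]
    refine Finset.sum_congr rfl fun ρ _ => ?_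
    rw [map_mul, Complex.normSq_eq_conj_mul_self, mul_comm]
    exact congrArg (· * ρ a) (hσ (ρ : K →+* ℂ) a)
  have h' : ((twistedTraceForm K σ a a : ℚ) : ℝ) = ∑ ρ : K →ₐ[ℚ] ℂ, Complex.normSq (ρ a) := by
    exact_mod_cast h
  have hpos : (0 : ℝ) < ∑ ρ : K →ₐ[ℚ] ℂ, Complex.normSq (ρ a) := by
    obtain ⟨ρ⟩ : Nonempty (K →+* ℂ) := inferInstance
    refine Finset.sum_pos (fun τ _ => ?_) ⟨ρ.toRatAlgHom, Finset.mem_univ _⟩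
    exact Complex.normSq_pos.2 ((map_ne_zero τ).2 ha)
  rw [← h'] at hpos
  exact_mod_cast hpos

end TwistedTraceForm

/-- Expansion of a vector in an orthogonal basis with non-isotropic vectors. -/
theorem LinearMap.BilinForm.sum_div_smul_of_isOrthoᵢ {F E ι : Type*} [Field F] [AddCommGroup E]
    [Module F E] [Fintype ι] {h : LinearMap.BilinForm F E} {e : Module.Basis ι F E}
    (he : h.IsOrthoᵢ e) (hne : ∀ i, h (e i) (e i) ≠ 0) (x : E) :
    ∑ i, (h x (e i) / h (e i) (e i)) • e i = x := by
  classical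
  conv_rhs => rw [← e.sum_repr x]
  refine Finset.sum_congr rfl fun i _ => ?_
  congr 1
  rw [div_eq_iff (hne i)]
  conv_lhs => rw [← e.sum_repr x]
  rw [map_sum, LinearMap.sum_apply, Finset.sum_eq_single i]
  · simp
  · intro j _ hj
    have : h (e j) (e i) = 0 := he hj
    simp [this]
  · simp

section WeightedSum

variable {K V ι : Type*} [Field K] [Algebra ℚ K] [AddCommGroup V] [Module ℚ V] [Module K V]
  [IsScalarTower ℚ K V] [Fintype ι]

/-- The form `(x, y) ↦ ∑ i, c i * B (e i • x) (e i • y)`. -/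
noncomputable def weightedSumForm (B : LinearMap.BilinForm ℚ V) (c : ι → ℚ) (e : ι → K) :
    LinearMap.BilinForm ℚ V :=
  ∑ i, c i • B.compl₁₂ ((LinearMap.lsmul K V (e i)).restrictScalars ℚ)
    ((LinearMap.lsmul K V (e i)).restrictScalars ℚ)

theorem weightedSumForm_apply (B : LinearMap.BilinForm ℚ V) (c : ι → ℚ) (e : ι → K) (x y : V) :
    weightedSumForm B c e x y = ∑ i, c i * B (e i • x) (e i • y) := by
  simp [weightedSumForm, LinearMap.sum_apply]

theorem baseChange_weightedSumForm_apply (B : LinearMap.BilinForm ℚ V) (c : ι → ℚ) (e : ι → K)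
    (x y : ℂ ⊗[ℚ] V) :
    (weightedSumForm B c e).baseChange ℂ x y =
      ∑ i, (c i : ℂ) * B.baseChange ℂ (actionC K V (e i) x) (actionC K V (e i) y) := by
  induction x with
  | zero => simp
  | add x₁ x₂ h₁ h₂ => simp [h₁, h₂, mul_add, Finset.sum_add_distrib]
  | tmul z v =>
    induction y with
    | zero => simp
    | add y₁ y₂ h₁ h₂ => simp [h₁, h₂, mul_add, Finset.sum_add_distrib]
    | tmul w u =>
      simp only [actionC, LinearMap.baseChange_tmul, LinearMap.BilinForm.baseChange_tmul,
        weightedSumForm_apply, LinearMap.coe_restrictScalars, LinearMap.lsmul_apply,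
        Algebra.smul_def, eq_ratCast, Rat.cast_mul, Rat.cast_sum, Finset.sum_mul]
      exact Finset.sum_congr rfl fun i _ => by ring

end WeightedSum

theorem weightedSumForm_smul_left {K V ι : Type*} [Field K] [NumberField K] {σ : K ≃ₐ[ℚ] K}
    [AddCommGroup V] [Module ℚ V] [Module K V] [IsScalarTower ℚ K V] [Fintype ι]
    (hσ : ∀ a, σ (σ a) = a) (B : LinearMap.BilinForm ℚ V) {e : Module.Basis ι ℚ K}
    (he : (twistedTraceForm K σ).IsOrthoᵢ e) (hne : ∀ i, twistedTraceForm K σ (e i) (e i) ≠ 0)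
    (a : K) (x y : V) :
    weightedSumForm B (fun i => (twistedTraceForm K σ (e i) (e i))⁻¹) e (a • x) y =
      weightedSumForm B (fun i => (twistedTraceForm K σ (e i) (e i))⁻¹) e x (σ a • y) := by
  set h := twistedTraceForm K σ
  have expand (b : K) (v : V) (i : ι) :
      e i • b • v = ∑ j, (h (b * e i) (e j) / h (e j) (e j)) • e j • v := by
    simp_rw [← smul_assoc, ← Finset.sum_smul,
      LinearMap.BilinForm.sum_div_smul_of_isOrthoᵢ he hne, smul_eq_mul, mul_comm]
  simp only [weightedSumForm_apply, expand, map_sum, map_smul, LinearMap.sum_apply,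
    LinearMap.smul_apply, smul_eq_mul, Finset.mul_sum]
  rw [Finset.sum_comm]
  refine Finset.sum_congr rfl fun i _ => Finset.sum_congr rfl fun j _ => ?_
  rw [twistedTraceForm_mul_left hσ a (e j) (e i)]
  ring

/-- If a `K`-stable subspace `W ⊆ V_ℂ` is isotropic for the complexification
of some symmetric positive definite form on `V`, then it is isotropic for the
complexification of one that is moreover `K`-compatible (weight-2 case of the
polarization lemma). -/
theorem exists_compatible_polarization_weight_two
    (K : Type*) [Field K] [NumberField K]
    (σ : K ≃ₐ[ℚ] K)
    (hσ : ∀ (ρ : K →+* ℂ) (a : K), ρ (σ a) = (starRingEnd ℂ) (ρ a))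
    (V : Type*) [AddCommGroup V] [Module ℚ V] [Module K V] [IsScalarTower ℚ K V]
    [FiniteDimensional ℚ V]
    (W : Submodule ℂ (ℂ ⊗[ℚ] V))
    (hstable : ∀ (a : K), ∀ w ∈ W, actionC K V a w ∈ W)
    (hex : ∃ B : LinearMap.BilinForm ℚ V,
      (∀ x y : V, B x y = B y x) ∧ (∀ x : V, x ≠ 0 → 0 < B x x) ∧
      (∀ x ∈ W, ∀ y ∈ W, B.baseChange ℂ x y = 0)) :
    ∃ B₂ : LinearMap.BilinForm ℚ V,
      (∀ x y : V, B₂ x y = B₂ y x) ∧ (∀ x : V, x ≠ 0 → 0 < B₂ x x) ∧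
      (∀ x ∈ W, ∀ y ∈ W, B₂.baseChange ℂ x y = 0) ∧
      (∀ (a : K) (x y : V), B₂ (a • x) y = B₂ x (σ a • y)) := by
  obtain ⟨B, hsymm, hpos, hiso⟩ := hex
  have hinv := involutive_of_forall_embedding_conj hσ
  obtain ⟨e, he⟩ := LinearMap.BilinForm.exists_orthogonal_basis
    (B := twistedTraceForm K σ) ⟨twistedTraceForm_comm hinv⟩
  have hd (i) : 0 < twistedTraceForm K σ (e i) (e i) :=
    twistedTraceForm_self_pos hσ (e.ne_zero i)
  refine ⟨weightedSumForm B (fun i => (twistedTraceForm K σ (e i) (e i))⁻¹) e,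
    fun x y => ?_, fun x hx => ?_, fun x hx y hy => ?_,
    weightedSumForm_smul_left hinv B he fun i => (hd i).ne'⟩
  · simp only [weightedSumForm_apply, hsymm (_ • x)]
  · rw [weightedSumForm_apply]
    refine Finset.sum_pos (fun i _ => mul_pos (inv_pos.2 (hd i))
      (hpos _ (smul_ne_zero (e.ne_zero i) hx))) ?_
    exact ⟨⟨0, Module.finrank_pos⟩, Finset.mem_univ _⟩
  · rw [baseChange_weightedSumForm_apply]
    refine Finset.sum_eq_zero fun i _ => ?_
    rw [hiso _ (hstable _ x hx) _ (hstable _ y hy), mul_zero]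
end

section
/- Let E be a number field and σ : E → E a ℚ-algebra automorphism such that ρ(σ(a)) = conj(ρ(a)) for every ring embedding ρ : E → ℂ. Let V be a finite-dimensional E-vector space and B : V × V → ℚ a ℚ-bilinear form with B(a•x, y) = B(x, σ(a)•y) for all a ∈ E. Then there is a unique function H : V × V → E such that Tr_{E/ℚ}(a·H(x,y)) = B(a•x, y) for all a ∈ E and x,y ∈ V. This H satisfies: H is additive in each variable, H(a•x, y) = a·H(x,y), H(x, a•y) = σ(a)·H(x,y), and Tr_{E/ℚ}(H(x,y)) = B(x,y). Moreover, if ε ∈ {1,−1} and B(y,x) = ε·B(x,y) for all x,y, then H(y,x) = ε·σ(H(x,y)) for all x,y. -/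
/-- An element of a finite separable extension is determined by its trace pairings. -/
theorem eq_of_forall_trace_mul_eq {K L : Type*} [Field K] [Field L] [Algebra K L]
    [FiniteDimensional K L] [Algebra.IsSeparable K L] {u v : L}
    (h : ∀ a : L, Algebra.trace K L (a * u) = Algebra.trace K L (a * v)) : u = v := by
  refine sub_eq_zero.mp ((traceForm_nondegenerate K L).2 _ fun a => ?_)
  rw [Algebra.traceForm_apply, mul_sub, map_sub, h, sub_self]

/-- Every linear functional on a finite separable extension is a trace pairing. -/
theorem exists_forall_trace_mul_eq {K L : Type*} [Field K] [Field L] [Algebra K L]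
    [FiniteDimensional K L] [Algebra.IsSeparable K L] (f : L →ₗ[K] K) :
    ∃ u : L, ∀ a : L, Algebra.trace K L (a * u) = f a := by
  refine ⟨((Algebra.traceForm K L).toDual (traceForm_nondegenerate K L)).symm f, fun a => ?_⟩
  rw [mul_comm, ← Algebra.traceForm_apply]
  exact LinearMap.BilinForm.apply_toDual_symm_apply f a

/-- An endomorphism that every complex embedding turns into complex conjugation is an
involution. -/
theorem NumberField.involutive_of_forall_embedding_eq_conj {E : Type*} [Field E] [NumberField E]
    {σ : E → E} (hσ : ∀ (ρ : E →+* ℂ) (a : E), ρ (σ a) = (starRingEnd ℂ) (ρ a)) :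
    Function.Involutive σ := by
  obtain ⟨ρ⟩ : Nonempty (E →+* ℂ) := inferInstance
  intro a
  apply ρ.injective
  rw [hσ, hσ, Complex.conj_conj]

/-- Existence and uniqueness of the (±1)-hermitian form `H : V × V → E`
with `Tr_{E/ℚ} (a * H x y) = B (a • x) y`, together with its sesquilinearity and
symmetry properties. -/
theorem exists_unique_hermitian_lift
    (E : Type*) [Field E] [NumberField E]
    (σ : E ≃ₐ[ℚ] E)
    (hσ : ∀ (ρ : E →+* ℂ) (a : E), ρ (σ a) = (starRingEnd ℂ) (ρ a))
    (V : Type*) [AddCommGroup V] [Module ℚ V] [Module E V] [IsScalarTower ℚ E V]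
    [FiniteDimensional E V]
    (B : LinearMap.BilinForm ℚ V)
    (hcompat : ∀ (a : E) (x y : V), B (a • x) y = B x (σ a • y)) :
    (∃! H : V → V → E,
      ∀ (a : E) (x y : V), Algebra.trace ℚ E (a * H x y) = B (a • x) y) ∧
    (∀ H : V → V → E,
      (∀ (a : E) (x y : V), Algebra.trace ℚ E (a * H x y) = B (a • x) y) →
      ((∀ x x' y : V, H (x + x') y = H x y + H x' y) ∧
       (∀ x y y' : V, H x (y + y') = H x y + H x y') ∧
       (∀ (a : E) (x y : V), H (a • x) y = a * H x y) ∧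
       (∀ (a : E) (x y : V), H x (a • y) = σ a * H x y) ∧
       (∀ x y : V, Algebra.trace ℚ E (H x y) = B x y) ∧
       (∀ ε : ℚ, (ε = 1 ∨ ε = -1) → (∀ x y : V, B y x = ε * B x y) →
         ∀ x y : V, H y x = algebraMap ℚ E ε * σ (H x y)))) := by
  have hinv := NumberField.involutive_of_forall_embedding_eq_conj hσ
  refine ⟨?_, fun H hH => ⟨fun x x' y => ?_, fun x y y' => ?_, fun a x y => ?_, fun a x y => ?_,
    fun x y => ?_, fun ε _ hB x y => ?_⟩⟩
  · have hex : ∀ x y : V, ∃ u : E, ∀ a : E, Algebra.trace ℚ E (a * u) = B (a • x) y :=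
      fun x y => exists_forall_trace_mul_eq
        ((B.flip y).comp ((LinearMap.toSpanSingleton E V x).restrictScalars ℚ))
    choose H hH using hex
    refine ⟨H, fun a x y => hH x y a, fun H' hH' => ?_⟩
    funext x y
    exact eq_of_forall_trace_mul_eq fun a => (hH' a x y).trans (hH x y a).symm
  · refine eq_of_forall_trace_mul_eq (K := ℚ) fun b => ?_
    rw [mul_add, map_add, hH, hH, hH, smul_add, map_add, LinearMap.add_apply]
  · refine eq_of_forall_trace_mul_eq (K := ℚ) fun b => ?_
    rw [mul_add, map_add, hH, hH, hH, map_add]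
  · refine eq_of_forall_trace_mul_eq (K := ℚ) fun b => ?_
    rw [← mul_assoc, hH, hH, mul_smul]
  · refine eq_of_forall_trace_mul_eq (K := ℚ) fun b => ?_
    rw [← mul_assoc, hH, hH, mul_comm, mul_smul, hcompat (σ a), hinv a]
  · rw [← one_mul (H x y), hH, one_smul]
  · refine eq_of_forall_trace_mul_eq (K := ℚ) fun b => ?_
    have hσb : b * σ (H x y) = σ (σ b * H x y) := by rw [map_mul, hinv b]
    rw [hH, hcompat, hB, mul_left_comm, ← Algebra.smul_def, hσb, (Algebra.trace ℚ E).map_smul,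
      Algebra.trace_eq_of_algEquiv, hH, smul_eq_mul]
end

section
/- Let L be a division ring that is a finite-dimensional ℚ-algebra, equipped with a ℚ-linear map x ↦ x̄ satisfying (x·y)‾ = ȳ·x̄, overline of overline of x equals x, and 1̄ = 1 (an involution), which is positive in the sense that T(x·x̄) > 0 for every nonzero x ∈ L, where T(y) denotes the trace of the ℚ-linear endomorphism 'left multiplication by y' of L. Let V be a left L-module that is finite-dimensional over ℚ. Then there exists a symmetric positive definite ℚ-bilinear form B on V such that B(u•x, y) = B(x, ū•y) for all u ∈ L and x, y ∈ V. -/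
/-- The sum over coordinates of the trace form `(a, b) ↦ T (a * inv b)`. -/
noncomputable def coordTraceForm {L V ι : Type*} [DivisionRing L] [Algebra ℚ L]
    [AddCommGroup V] [Module ℚ V] [Module L V] [IsScalarTower ℚ L V] [Fintype ι]
    (inv : L →ₗ[ℚ] L) (b : Module.Basis ι L V) : LinearMap.BilinForm ℚ V :=
  ∑ i, ((LinearMap.mul ℚ L).compr₂ (LinearMap.trace ℚ L ∘ₗ LinearMap.mul ℚ L)).compl₁₂
    ((b.coord i).restrictScalars ℚ) (inv ∘ₗ (b.coord i).restrictScalars ℚ)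

theorem coordTraceForm_apply {L V ι : Type*} [DivisionRing L] [Algebra ℚ L]
    [AddCommGroup V] [Module ℚ V] [Module L V] [IsScalarTower ℚ L V] [Fintype ι]
    (inv : L →ₗ[ℚ] L) (b : Module.Basis ι L V) (x y : V) :
    coordTraceForm inv b x y =
      ∑ i, LinearMap.trace ℚ L (LinearMap.mulLeft ℚ (b.repr x i * inv (b.repr y i))) := by
  simp only [coordTraceForm, LinearMap.sum_apply]
  rfl

theorem trace_mulLeft_mul_comm {L : Type*} [Ring L] [Algebra ℚ L] (x y : L) :
    LinearMap.trace ℚ L (LinearMap.mulLeft ℚ (x * y)) =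
      LinearMap.trace ℚ L (LinearMap.mulLeft ℚ (y * x)) := by
  simp only [LinearMap.mulLeft_mul, ← Module.End.mul_eq_comp]
  exact LinearMap.trace_mul_comm ℚ _ _


/-- For a division algebra `L` over ℚ with a positive involution, every
left `L`-module `V` finite-dimensional over ℚ carries a symmetric positive definite
ℚ-bilinear form `B` with `B (u • x) y = B x (ū • y)`. -/
theorem exists_invariant_posdef_form
    (L : Type*) [DivisionRing L] [Algebra ℚ L] [FiniteDimensional ℚ L]
    (inv : L →ₗ[ℚ] L)
    (hmul : ∀ x y : L, inv (x * y) = inv y * inv x)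
    (hinv : ∀ x : L, inv (inv x) = x)
    (hone : inv 1 = 1)
    (hposinv : ∀ x : L, x ≠ 0 →
      0 < LinearMap.trace ℚ L (LinearMap.mulLeft ℚ (x * inv x)))
    (V : Type*) [AddCommGroup V] [Module ℚ V] [Module L V] [IsScalarTower ℚ L V]
    [FiniteDimensional ℚ V] :
    ∃ B : LinearMap.BilinForm ℚ V,
      (∀ x y : V, B x y = B y x) ∧
      (∀ x : V, x ≠ 0 → 0 < B x x) ∧
      (∀ (u : L) (x y : V), B (u • x) y = B x (inv u • y)) := by
  have : Module.Finite L V := Module.Finite.of_restrictScalars_finite ℚ L V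
  let b := Module.finBasis L V
  let B := coordTraceForm inv b
  have hB (u : L) (x y : V) : B (u • x) y = B x (inv u • y) := by
    simp only [B, coordTraceForm_apply, map_smul, Finsupp.smul_apply, smul_eq_mul, hmul, hinv]
    refine Finset.sum_congr rfl fun i _ => ?_
    rw [mul_assoc, trace_mulLeft_mul_comm, mul_assoc]
  have hpos (x : V) (hx : x ≠ 0) : 0 < B x x := by
    simp only [B, coordTraceForm_apply]
    obtain ⟨i, hi⟩ : ∃ i, b.repr x i ≠ 0 := by
      by_contra! h
      exact hx (b.repr.map_eq_zero_iff.mp (Finsupp.ext h))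
    refine Finset.sum_pos' (fun j _ => ?_) ⟨i, Finset.mem_univ i, hposinv _ hi⟩
    by_cases hj : b.repr x j = 0
    · simp [hj]
    · exact (hposinv _ hj).le
  refine ⟨B + LinearMap.flip B, fun x y => ?_, fun x hx => ?_, fun u x y => ?_⟩
  · simp only [LinearMap.add_apply, LinearMap.flip_apply]
    exact add_comm _ _
  · simp only [LinearMap.add_apply, LinearMap.flip_apply]
    exact add_pos (hpos x hx) (hpos x hx)
  · simp only [LinearMap.add_apply, LinearMap.flip_apply, hB, hinv]
end

section
/- Let V be a ℚ-vector space of dimension 2n with a symmetric positive definite ℚ-bilinear form B, and let W ⊆ V_ℂ be an n-dimensional ℂ-subspace that is isotropic for B_ℂ. Then c(W) is also isotropic for B_ℂ, W ∩ c(W) = 0, and V_ℂ = W ⊕ c(W). -/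
open TensorProduct

/-- Complex conjugation `c = id_V ⊗ conj` on `V_ℂ = ℂ ⊗[ℚ] V`. -/
noncomputable def conjC (V : Type*) [AddCommGroup V] [Module ℚ V] :
    (ℂ ⊗[ℚ] V) →ₗ[ℚ] (ℂ ⊗[ℚ] V) :=
  LinearMap.rTensor V ((Complex.conjAe.toLinearMap).restrictScalars ℚ)

theorem conjC_tmul {V : Type*} [AddCommGroup V] [Module ℚ V] (z : ℂ) (v : V) :
    conjC V (z ⊗ₜ v) = (starRingEnd ℂ z) ⊗ₜ v := rfl

theorem conjC_conjC {V : Type*} [AddCommGroup V] [Module ℚ V] (x : ℂ ⊗[ℚ] V) :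
    conjC V (conjC V x) = x := by
  induction x with
  | zero => simp
  | tmul z v => simp [conjC_tmul]
  | add x y hx hy => simp [hx, hy]

theorem conjC_smul {V : Type*} [AddCommGroup V] [Module ℚ V] (a : ℂ) (x : ℂ ⊗[ℚ] V) :
    conjC V (a • x) = starRingEnd ℂ a • conjC V x := by
  induction x with
  | zero => simp
  | tmul z v => simp [conjC_tmul, smul_tmul']
  | add x y hx hy => simp [hx, hy]

theorem baseChange_conjC_conjC {V : Type*} [AddCommGroup V] [Module ℚ V]
    (B : LinearMap.BilinForm ℚ V) (x y : ℂ ⊗[ℚ] V) :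
    B.baseChange ℂ (conjC V x) (conjC V y) = starRingEnd ℂ (B.baseChange ℂ x y) := by
  induction x with
  | zero => simp
  | add x x' hx hx' => simp [hx, hx']
  | tmul z v =>
    induction y with
    | zero => simp
    | add y y' hy hy' => simp [hy, hy']
    | tmul w u => simp [conjC_tmul, LinearMap.BilinForm.baseChange_tmul, Algebra.smul_def]

/-- The Hermitian form `B_ℂ(c x, x)` attached to a positive definite form is anisotropic. -/
theorem eq_zero_of_baseChange_conjC_self {V : Type*} [AddCommGroup V] [Module ℚ V]
    [FiniteDimensional ℚ V] {B : LinearMap.BilinForm ℚ V}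
    (hsymm : ∀ x y : V, B x y = B y x) (hpos : ∀ x : V, x ≠ 0 → 0 < B x x)
    {x : ℂ ⊗[ℚ] V} (hx : B.baseChange ℂ (conjC V x) x = 0) : x = 0 := by
  obtain ⟨v, hv⟩ := LinearMap.BilinForm.exists_orthogonal_basis (B := B) ⟨hsymm⟩
  set b := v.baseChange ℂ with hb
  have hsum : x = ∑ i, b.repr x i ⊗ₜ[ℚ] v i := by
    conv_lhs => rw [← b.sum_repr x]
    simp [hb, smul_tmul']
  have hH : B.baseChange ℂ (conjC V x) x =
      ((∑ i, Complex.normSq (b.repr x i) * (B (v i) (v i) : ℝ) : ℝ) : ℂ) := by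
    conv_lhs => rw [hsum]
    simp only [map_sum, LinearMap.sum_apply, conjC_tmul, LinearMap.BilinForm.baseChange_tmul]
    push_cast
    refine Finset.sum_congr rfl fun i _ => ?_
    rw [Finset.sum_eq_single i]
    · rw [Complex.normSq_eq_conj_mul_self, Algebra.smul_def, mul_comm]
      simp [mul_comm]
    · intro j _ hji
      have : B (v j) (v i) = 0 := hv hji
      simp [this]
    · simp
  rw [hH, Complex.ofReal_eq_zero] at hx
  have hvpos (i) : (0 : ℝ) < B (v i) (v i) := by exact_mod_cast hpos _ (v.ne_zero i)
  rw [Finset.sum_eq_zero_iff_of_nonneg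
    fun i _ => mul_nonneg (Complex.normSq_nonneg _) (hvpos i).le] at hx
  refine b.ext_elem fun i => ?_
  have := hx i (Finset.mem_univ i)
  simpa [(hvpos i).ne'] using this

/-- The image of a complex subspace under `conjC`, as a complex subspace. -/
noncomputable def conjSubmodule {V : Type*} [AddCommGroup V] [Module ℚ V]
    (W : Submodule ℂ (ℂ ⊗[ℚ] V)) : Submodule ℂ (ℂ ⊗[ℚ] V) where
  __ := (Submodule.map (conjC V) (W.restrictScalars ℚ)).toAddSubmonoid
  smul_mem' := by
    rintro a _ ⟨x, hx, rfl⟩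
    exact ⟨starRingEnd ℂ a • x, W.smul_mem _ hx, by simp [conjC_smul]⟩

theorem restrictScalars_conjSubmodule {V : Type*} [AddCommGroup V] [Module ℚ V]
    (W : Submodule ℂ (ℂ ⊗[ℚ] V)) :
    (conjSubmodule W).restrictScalars ℚ = Submodule.map (conjC V) (W.restrictScalars ℚ) := rfl

theorem finrank_conjSubmodule {V : Type*} [AddCommGroup V] [Module ℚ V]
    (W : Submodule ℂ (ℂ ⊗[ℚ] V)) :
    Module.finrank ℂ (conjSubmodule W) = Module.finrank ℂ W := by
  let e : W ≃+ conjSubmodule W :=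
    { toFun := fun x => ⟨conjC V x, x, x.2, rfl⟩
      invFun := fun y => ⟨conjC V y, by
        obtain ⟨_, x, hx, rfl⟩ := y
        simpa [conjC_conjC] using hx⟩
      left_inv := fun x => Subtype.ext (conjC_conjC _)
      right_inv := fun y => Subtype.ext (conjC_conjC _)
      map_add' := fun x y => Subtype.ext (map_add _ _ _) }
  exact congrArg Cardinal.toNat (rank_eq_of_equiv_equiv (starRingEnd ℂ) e
    (starRingAut (R := ℂ)).bijective
    fun a x => Subtype.ext (conjC_smul a (x : ℂ ⊗[ℚ] V))).symm

/-- For a positive definite symmetric form `B` on a `2n`-dimensional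
ℚ-vector space `V` and an `n`-dimensional isotropic ℂ-subspace `W ⊆ V_ℂ`, the conjugate
`c(W)` is isotropic, `W ∩ c(W) = 0`, and `V_ℂ = W ⊕ c(W)`. -/
theorem isotropic_conj_complement (n : ℕ) (V : Type*) [AddCommGroup V] [Module ℚ V]
    [FiniteDimensional ℚ V] (hdim : Module.finrank ℚ V = 2 * n)
    (B : LinearMap.BilinForm ℚ V)
    (hsymm : ∀ x y : V, B x y = B y x)
    (hpos : ∀ x : V, x ≠ 0 → 0 < B x x)
    (W : Submodule ℂ (ℂ ⊗[ℚ] V))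
    (hW : Module.finrank ℂ W = n)
    (hisot : ∀ x ∈ W, ∀ y ∈ W, B.baseChange ℂ x y = 0) :
    (∀ x ∈ Submodule.map (conjC V) (W.restrictScalars ℚ),
       ∀ y ∈ Submodule.map (conjC V) (W.restrictScalars ℚ), B.baseChange ℂ x y = 0) ∧
    (W.restrictScalars ℚ ⊓ Submodule.map (conjC V) (W.restrictScalars ℚ) = ⊥) ∧
    (W.restrictScalars ℚ ⊔ Submodule.map (conjC V) (W.restrictScalars ℚ) = ⊤) := by
  have hinf : W.restrictScalars ℚ ⊓ Submodule.map (conjC V) (W.restrictScalars ℚ) = ⊥ := by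
    rw [Submodule.eq_bot_iff]
    rintro _ ⟨hx, w, hw, rfl⟩
    refine eq_zero_of_baseChange_conjC_self hsymm hpos ?_
    rw [conjC_conjC]
    exact hisot _ hw _ hx
  refine ⟨?_, hinf, ?_⟩
  · rintro _ ⟨x, hx, rfl⟩ _ ⟨y, hy, rfl⟩
    rw [baseChange_conjC_conjC, hisot x hx y hy, map_zero]
  · rw [← restrictScalars_conjSubmodule] at hinf ⊢
    have hinf' : W ⊓ conjSubmodule W = ⊥ :=
      Submodule.restrictScalars_injective ℚ ℂ _ hinf
    have hsup : W ⊔ conjSubmodule W = ⊤ := by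
      apply Submodule.eq_top_of_finrank_eq
      have h := Submodule.finrank_sup_add_finrank_inf_eq W (conjSubmodule W)
      rw [hinf', finrank_bot, finrank_conjSubmodule, hW] at h
      rw [Module.finrank_baseChange, hdim]
      omega
    rw [← Submodule.restrictScalars_sup, hsup, Submodule.restrictScalars_top]
end

section
/- Let F be a totally real number field and V a nonzero finite-dimensional F-vector space, with B a symmetric positive definite ℚ-bilinear form on V (viewed as a ℚ-vector space) satisfying B(a•x, y) = B(x, a•y) for all a ∈ F. Let W ⊆ V_ℂ be a ℂ-subspace that is isotropic for B_ℂ, stable under a ⊗ 1 for every a ∈ F, and of ℂ-dimension equal to half the ℚ-dimension of V. Then dim_F V is even; consequently [F:ℚ] divides dim_ℂ W. -/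
open TensorProduct

open Module

section BilinearForms

variable {K M : Type*} [Field K] [AddCommGroup M] [Module K M]

/-- If a self-adjoint endomorphism is diagonalizable, then a nondegenerate symmetric form stays
nondegenerate on each of its eigenspaces. -/
theorem nondegenerate_restrict_eigenspace {C : LinearMap.BilinForm K M} (hC : C.Nondegenerate)
    (hsymm : ∀ x y, C x y = C y x) {f : End K M} (hf : ∀ x y, C (f x) y = C x (f y))
    (htop : ⨆ μ, f.eigenspace μ = ⊤) (μ : K) :
    (C.restrict (f.eigenspace μ)).Nondegenerate := by
  have key : ∀ x ∈ f.eigenspace μ, (∀ y ∈ f.eigenspace μ, C x y = 0) → x = 0 := by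
    intro x hx hxy
    refine hC.1 x fun y => ?_
    have hy : y ∈ ⨆ ν, f.eigenspace ν := htop ▸ Submodule.mem_top
    induction hy using Submodule.iSup_induction' with
    | zero => simp
    | add y z _ _ hy hz => rw [map_add, hy, hz, add_zero]
    | mem ν y hy =>
      obtain rfl | hne := eq_or_ne μ ν
      · exact hxy y hy
      · have h := hf x y
        rw [End.mem_eigenspace_iff.1 hx, End.mem_eigenspace_iff.1 hy, map_smul, map_smul,
          LinearMap.smul_apply, smul_eq_mul, smul_eq_mul, ← sub_eq_zero, ← sub_mul] at h
        exact (mul_eq_zero.1 h).resolve_left (sub_ne_zero.2 hne)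
  refine ⟨fun x hx => Subtype.ext (key x x.2 fun y hy => hx ⟨y, hy⟩),
    fun x hx => Subtype.ext (key x x.2 fun y hy => ?_)⟩
  rw [hsymm]
  exact hx ⟨y, hy⟩

variable [FiniteDimensional K M]

/-- An isotropic subspace for a nondegenerate form has at most half the total dimension. -/
theorem two_mul_finrank_le_of_isotropic {C : LinearMap.BilinForm K M} (hC : C.Nondegenerate)
    (U : Submodule K M) (hU : ∀ x ∈ U, ∀ y ∈ U, C x y = 0) :
    2 * finrank K U ≤ finrank K M := by
  have h := C.finrank_orthogonal hC U
  have hle : finrank K U ≤ finrank K (C.orthogonal U) :=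
    Submodule.finrank_mono fun y hy x hx => hU x hx y hy
  have := U.finrank_le
  omega

/-- A finite-dimensional base change of a nondegenerate bilinear form is nondegenerate. -/
theorem nondegenerate_baseChange (L : Type*) [Field L] [Algebra K L]
    {C : LinearMap.BilinForm K M} (hC : C.Nondegenerate) :
    (C.baseChange L).Nondegenerate := by
  classical
  let b := Module.finBasis K M
  rw [LinearMap.BilinForm.nondegenerate_iff_det_ne_zero b] at hC
  rw [LinearMap.BilinForm.nondegenerate_iff_det_ne_zero (b.baseChange L)]
  have h : LinearMap.BilinForm.toMatrix (b.baseChange L) (C.baseChange L) =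
      (LinearMap.BilinForm.toMatrix b C).map (algebraMap K L) := by
    ext i j
    simp [LinearMap.BilinForm.toMatrix_apply, Algebra.algebraMap_eq_smul_one]
  rw [h, ← RingHom.mapMatrix_apply, ← RingHom.map_det]
  simpa using hC

end BilinearForms

section Eigenspaces

theorem coe_aeval_restrict_apply {R M : Type*} [CommRing R] [AddCommGroup M] [Module R M]
    {f : End R M} {N : Submodule R M} (hN : ∀ x ∈ N, f x ∈ N) (p : Polynomial R) (x : N) :
    (Polynomial.aeval (f.restrict hN) p x : M) = Polynomial.aeval f p (x : M) := by
  induction p using Polynomial.induction_on' with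
  | add p q hp hq => simp [hp, hq]
  | monomial n a =>
    rw [Polynomial.aeval_monomial, Polynomial.aeval_monomial, End.pow_restrict]
    rfl

variable {K M : Type*} [Field K] [IsAlgClosed K] [AddCommGroup M] [Module K M]
  [FiniteDimensional K M]

theorem iSup_eigenspace_eq_top_of_squarefree {g : End K M} {p : Polynomial K}
    (hp : Squarefree p) (hg : Polynomial.aeval g p = 0) : ⨆ μ, g.eigenspace μ = ⊤ := by
  have hss := (End.isSemisimple_of_squarefree_aeval_eq_zero hp hg).isFinitelySemisimple
  rw [← g.iSup_maxGenEigenspace_eq_top]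
  exact iSup_congr fun μ => (hss.maxGenEigenspace_eq_eigenspace μ).symm

/-- A bound for the dimension of a space on which a squarefree polynomial annihilates an
endomorphism, in terms of a uniform bound for the dimensions of the eigenspaces. -/
theorem finrank_le_natDegree_mul {g : End K M} {p : Polynomial K}
    (hp : Squarefree p) (hg : Polynomial.aeval g p = 0) {k : ℕ}
    (hk : ∀ μ, finrank K (g.eigenspace μ) ≤ k) : finrank K M ≤ p.natDegree * k := by
  classical
  have hsup : ∀ s : Finset K, finrank K (s.sup g.eigenspace : Submodule K M) ≤ s.card * k := by
    intro s
    induction s using Finset.induction_on with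
    | empty => simp
    | insert a s ha ih =>
      rw [Finset.sup_insert, Finset.card_insert_of_notMem ha]
      have := Submodule.finrank_add_le_finrank_add_finrank (g.eigenspace a) (s.sup g.eigenspace)
      have := hk a
      linarith
  have htop : p.roots.toFinset.sup g.eigenspace = ⊤ := by
    rw [eq_top_iff, ← iSup_eigenspace_eq_top_of_squarefree hp hg]
    refine iSup_le fun μ => ?_
    obtain h | h := eq_or_ne (g.eigenspace μ) ⊥
    · simp [h]
    · refine Finset.le_sup (f := g.eigenspace) ?_
      obtain ⟨x, hx⟩ := End.HasEigenvalue.exists_hasEigenvector (f := g) (μ := μ) h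
      have hroot := End.aeval_apply_of_hasEigenvector (p := p) hx
      rw [hg, LinearMap.zero_apply] at hroot
      rw [Multiset.mem_toFinset, Polynomial.mem_roots hp.ne_zero]
      exact (smul_eq_zero.1 hroot.symm).resolve_right hx.2
  calc finrank K M = finrank K (p.roots.toFinset.sup g.eigenspace : Submodule K M) := by
        rw [htop, finrank_top]
    _ ≤ p.roots.toFinset.card * k := hsup _
    _ ≤ p.natDegree * k :=
        Nat.mul_le_mul_right _ ((Multiset.toFinset_card_le _).trans p.card_roots')

end Eigenspaces

section ActionC

variable (F V : Type*) [Field F] [NumberField F] [AddCommGroup V] [Module ℚ V] [Module F V]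
  [IsScalarTower ℚ F V]

/-- `actionC` as an algebra homomorphism. -/
noncomputable def actionCHom : F →ₐ[ℚ] End ℂ (ℂ ⊗[ℚ] V) :=
  (End.baseChangeHom ℚ ℂ V).comp (Algebra.lsmul ℚ ℚ V)

variable {F V}

theorem actionCHom_apply (a : F) : actionCHom F V a = actionC F V a := rfl

@[simp]
theorem actionC_tmul (a : F) (z : ℂ) (v : V) : actionC F V a (z ⊗ₜ v) = z ⊗ₜ (a • v) := rfl

theorem baseChange_actionC {B : LinearMap.BilinForm ℚ V}
    (hB : ∀ (a : F) (x y : V), B (a • x) y = B x (a • y)) (a : F) (x y : ℂ ⊗[ℚ] V) :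
    B.baseChange ℂ (actionC F V a x) y = B.baseChange ℂ x (actionC F V a y) := by
  induction x with
  | zero => simp
  | add x x' hx hx' => simp only [map_add, LinearMap.add_apply, hx, hx']
  | tmul z v =>
    induction y with
    | zero => simp
    | add y y' hy hy' => simp only [map_add, hy, hy']
    | tmul w u => simp [hB]

theorem aeval_actionC_minpoly (a : F) :
    Polynomial.aeval (actionC F V a) ((minpoly ℚ a).map (algebraMap ℚ ℂ)) = 0 := by
  rw [Polynomial.aeval_map_algebraMap, ← actionCHom_apply, Polynomial.aeval_algHom_apply,
    minpoly.aeval, map_zero]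

theorem squarefree_map_minpoly (a : F) :
    Squarefree ((minpoly ℚ a).map (algebraMap ℚ ℂ)) :=
  (Polynomial.Separable.map (Algebra.IsSeparable.isSeparable ℚ a)).squarefree

/-- An eigenvector of a generator of `F` is an eigenvector of every element of `F`. -/
theorem exists_actionC_eq_smul (pb : PowerBasis ℚ F) {μ : ℂ} {x : ℂ ⊗[ℚ] V}
    (hx : x ∈ End.eigenspace (actionC F V pb.gen) μ) (a : F) :
    ∃ c : ℂ, actionC F V a x = c • x := by
  obtain rfl | hx0 := eq_or_ne x 0
  · exact ⟨0, by simp⟩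
  obtain ⟨q, rfl⟩ := pb.exists_eq_aeval' a
  refine ⟨(q.map (algebraMap ℚ ℂ)).eval μ, ?_⟩
  rw [← End.aeval_apply_of_hasEigenvector ⟨hx, hx0⟩, Polynomial.aeval_map_algebraMap,
    ← actionCHom_apply, ← actionCHom_apply, Polynomial.aeval_algHom_apply]

/-- The eigenspaces of a generator of `F` on `ℂ ⊗[ℚ] V` have dimension at most `finrank F V`,
as soon as `V` carries a nondegenerate form for which `F` acts by self-adjoint operators. -/
theorem finrank_eigenspace_actionC_le [FiniteDimensional F V] {B : LinearMap.BilinForm ℚ V}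
    (hB : (B.baseChange ℂ).Nondegenerate)
    (hcompat : ∀ (a : F) (x y : V), B (a • x) y = B x (a • y)) (pb : PowerBasis ℚ F) (μ : ℂ) :
    finrank ℂ (End.eigenspace (actionC F V pb.gen) μ) ≤ finrank F V := by
  let b := Module.finBasis F V
  let φ : End.eigenspace (actionC F V pb.gen) μ →ₗ[ℂ] (Fin (finrank F V) → ℂ) :=
    LinearMap.pi fun i => ((B.baseChange ℂ).flip (1 ⊗ₜ b i)).comp (Submodule.subtype _)
  have hφ : Function.Injective φ := by
    rw [injective_iff_map_eq_zero]
    intro x hx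
    refine Subtype.ext (hB.1 x fun y => ?_)
    have hzero (i) (a : F) : B.baseChange ℂ (x : ℂ ⊗[ℚ] V) (1 ⊗ₜ (a • b i)) = 0 := by
      obtain ⟨c, hc⟩ := exists_actionC_eq_smul pb x.2 a
      rw [← actionC_tmul, ← baseChange_actionC hcompat, hc, map_smul, LinearMap.smul_apply,
        show B.baseChange ℂ (x : ℂ ⊗[ℚ] V) (1 ⊗ₜ b i) = 0 from congrFun hx i, smul_zero]
    induction y with
    | zero => simp
    | add y y' hy hy' => rw [map_add, hy, hy', add_zero]
    | tmul z v =>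
      rw [← mul_one z, ← smul_eq_mul, ← TensorProduct.smul_tmul', map_smul, ← b.sum_repr v,
        TensorProduct.tmul_sum, map_sum]
      simp [hzero]
  simpa using LinearMap.finrank_le_finrank_of_injective hφ

end ActionC

/-- For a Hodge structure of type `(n,0,n)` with endomorphisms by a totally
real field `F`, the `F`-dimension of `V` is even; consequently `[F:ℚ]` divides `n`. -/
theorem totally_real_divides (F : Type*) [Field F] [NumberField F]
    (htr : ∀ (ρ : F →+* ℂ) (a : F), (ρ a).im = 0)
    (V : Type*) [AddCommGroup V] [Module ℚ V] [Module F V] [IsScalarTower ℚ F V]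
    [FiniteDimensional F V] [Nontrivial V]
    (B : LinearMap.BilinForm ℚ V)
    (hsymm : ∀ x y : V, B x y = B y x)
    (hpos : ∀ x : V, x ≠ 0 → 0 < B x x)
    (hcompat : ∀ (a : F) (x y : V), B (a • x) y = B x (a • y))
    (W : Submodule ℂ (ℂ ⊗[ℚ] V))
    (hisot : ∀ x ∈ W, ∀ y ∈ W, B.baseChange ℂ x y = 0)
    (hstable : ∀ (a : F), ∀ w ∈ W, actionC F V a w ∈ W)
    (hdim : 2 * Module.finrank ℂ W = Module.finrank ℚ V) :
    Even (Module.finrank F V) ∧ Module.finrank ℚ F ∣ Module.finrank ℂ W := by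
  have : FiniteDimensional ℚ V := FiniteDimensional.trans ℚ F V
  have hnd : B.Nondegenerate :=
    ⟨fun x hx => by_contra fun h => (hpos x h).ne' (hx x),
      fun x hx => by_contra fun h => (hpos x h).ne' (hx x)⟩
  have hndC := nondegenerate_baseChange ℂ hnd
  have hsymmC (x y : ℂ ⊗[ℚ] V) : B.baseChange ℂ x y = B.baseChange ℂ y x :=
    (LinearMap.BilinForm.IsSymm.baseChange ℂ (B₂ := B) ⟨hsymm⟩).eq x y
  let pb := Field.powerBasisOfFiniteOfSeparable ℚ F
  let f : End ℂ (ℂ ⊗[ℚ] V) := actionC F V pb.gen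
  let p := (minpoly ℚ pb.gen).map (algebraMap ℚ ℂ)
  have hp : Squarefree p := squarefree_map_minpoly pb.gen
  have hfp : Polynomial.aeval f p = 0 := aeval_actionC_minpoly pb.gen
  have hdeg : p.natDegree = finrank ℚ F := by
    rw [Polynomial.natDegree_map, pb.natDegree_minpoly, pb.finrank]
  have hW : ∀ w ∈ W, f w ∈ W := hstable pb.gen
  let g : End ℂ W := f.restrict hW
  have hgp : Polynomial.aeval g p = 0 := by
    ext x
    simp [g, coe_aeval_restrict_apply, hfp]
  have hbound (μ : ℂ) : 2 * finrank ℂ (g.eigenspace μ) ≤ finrank F V := by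
    let U : Submodule ℂ (f.eigenspace μ) := W.comap (Submodule.subtype _)
    have hU : 2 * finrank ℂ U ≤ finrank ℂ (f.eigenspace μ) :=
      two_mul_finrank_le_of_isotropic
        (nondegenerate_restrict_eigenspace hndC hsymmC (baseChange_actionC hcompat pb.gen)
          (iSup_eigenspace_eq_top_of_squarefree hp hfp) μ) U
        fun x hx y hy => hisot x hx y hy
    have hgU : finrank ℂ (g.eigenspace μ) ≤ finrank ℂ U := by
      let ψ : g.eigenspace μ →ₗ[ℂ] U :=
        LinearMap.codRestrict U
          (LinearMap.codRestrict (f.eigenspace μ) (W.subtype.comp (Submodule.subtype _))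
            fun x => End.mem_eigenspace_iff.2
              (congrArg Subtype.val (End.mem_eigenspace_iff.1 x.2)))
          fun x => x.1.2
      refine LinearMap.finrank_le_finrank_of_injective (f := ψ) fun x y hxy => ?_
      exact Subtype.ext (Subtype.ext (congrArg (fun u => (u.1.1 : ℂ ⊗[ℚ] V)) hxy))
    have hf : finrank ℂ (f.eigenspace μ) ≤ finrank F V :=
      finrank_eigenspace_actionC_le hndC hcompat pb μ
    omega
  have hWle : finrank ℂ W ≤ finrank ℚ F * (finrank F V / 2) := by
    rw [← hdeg]
    exact finrank_le_natDegree_mul hp hgp fun μ => by have := hbound μ; omega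
  have hmul : finrank ℚ F * finrank F V = 2 * finrank ℂ W := by
    rw [hdim, finrank_mul_finrank]
  have heven : Even (finrank F V) := by
    have h : finrank ℚ F * finrank F V ≤ finrank ℚ F * (2 * (finrank F V / 2)) := by
      linarith
    have := Nat.le_of_mul_le_mul_left h finrank_pos
    exact ⟨finrank F V / 2, by omega⟩
  refine ⟨heven, ?_⟩
  obtain ⟨k, hk⟩ := heven
  refine ⟨k, ?_⟩
  rw [hk, mul_add] at hmul
  omega
end

section
/- Let F be a totally real number field with [F:ℚ] = n, and let V be an F-vector space with dim_F V = 2, equipped with a symmetric positive definite ℚ-bilinear form B (on V as ℚ-vector space) satisfying B(a•x, y) = B(x, a•y) for all a ∈ F. Let W ⊆ V_ℂ be an n-dimensional ℂ-subspace, isotropic for B_ℂ and stable under a ⊗ 1 for every a ∈ F. Then there exist an F-linear map φ : V → V and a totally positive element d ∈ F (i.e. τ(d) > 0 for every embedding τ : F → ℝ) such that φ∘φ = −d·id_V, B(φ(x), y) = −B(x, φ(y)) for all x, y ∈ V, and (φ ⊗ id_ℂ)(W) ⊆ W. -/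
open TensorProduct

/-- Every `ℚ`-linear functional on a number field is represented by the trace form. -/
theorem exists_forall_eq_trace_mul (F : Type*) [Field F] [NumberField F] (l : F →ₗ[ℚ] ℚ) :
    ∃ p : F, ∀ a, l a = Algebra.trace ℚ F (p * a) := by
  have h := traceForm_nondegenerate ℚ F
  refine ⟨((Algebra.traceForm ℚ F).toDual h).symm l, fun a => ?_⟩
  rw [← Algebra.traceForm_apply, LinearMap.BilinForm.apply_toDual_symm_apply]

/-- In a totally real field, if the form `a ↦ Tr (p * a * a)` is positive definite, then `p` is
totally positive. -/
theorem map_pos_of_forall_trace_pos {F : Type*} [Field F] [NumberField F]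
    (htr : ∀ (ρ : F →+* ℂ) (a : F), (ρ a).im = 0) {p : F}
    (hp : ∀ a : F, a ≠ 0 → 0 < Algebra.trace ℚ F (p * a * a)) (τ : F →+* ℝ) : 0 < τ p := by
  classical
  by_contra! hle
  have hp0 : p ≠ 0 := by
    rintro rfl
    simpa using hp 1 one_ne_zero
  have hneg : τ p < 0 := lt_of_le_of_ne hle ((map_ne_zero τ).2 hp0)
  let σ₀ : F →ₐ[ℚ] ℂ := (Complex.ofRealHom.comp τ).toRatAlgHom
  have hσ₀ (a : F) : σ₀ a = (τ a : ℂ) := rfl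
  have hre (σ : F →ₐ[ℚ] ℂ) (a : F) : σ a = ((σ a).re : ℂ) :=
    Complex.ext rfl (by simpa using htr σ.toRingHom a)
  have habs (σ : F →ₐ[ℚ] ℂ) (a : F) :
      NumberField.InfinitePlace.mk σ.toRingHom a = |(σ a).re| := by
    rw [NumberField.InfinitePlace.apply, ← Real.norm_eq_abs, ← Complex.norm_real, ← hre]
    rfl
  obtain ⟨a, ha, ha'⟩ := AbsoluteValue.exists_one_lt_lt_one_pi_of_not_isEquiv
    (v := fun v : NumberField.InfinitePlace F => v.1) (fun v => v.isNontrivial)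
    (fun v w hvw => NumberField.InfinitePlace.eq_iff_isEquiv.not.1 hvw)
    (NumberField.InfinitePlace.mk σ₀.toRingHom)
  have h1 : 1 < |τ a| := by
    have := habs σ₀ a
    rw [hσ₀, Complex.ofReal_re] at this
    rw [← this]
    exact ha
  have h2 (σ : F →ₐ[ℚ] ℂ) (hσ : σ ≠ σ₀) : |(σ a).re| < 1 := by
    rw [← habs]
    refine ha' _ fun h => hσ ?_
    ext z
    rcases NumberField.InfinitePlace.mk_eq_iff.1 h with h | h
    · exact RingHom.congr_fun h z
    · have hz := RingHom.congr_fun h z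
      rw [NumberField.ComplexEmbedding.conjugate_coe_eq] at hz
      rw [Complex.conj_eq_iff_im.2 (htr _ z)] at hz
      exact hz
  have ha0 : a ≠ 0 := by
    rintro rfl
    norm_num at h1
  have key (k : ℕ) : 0 < ∑ σ : F →ₐ[ℚ] ℂ, (σ p).re * ((σ a).re ^ 2) ^ k := by
    have h := hp (a ^ k) (pow_ne_zero _ ha0)
    have hE := trace_eq_sum_embeddings (K := ℚ) (L := F) ℂ (x := p * a ^ k * a ^ k)
    have hE' : ((Algebra.trace ℚ F (p * a ^ k * a ^ k) : ℚ) : ℝ) =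
        ∑ σ : F →ₐ[ℚ] ℂ, (σ p).re * ((σ a).re ^ 2) ^ k := by
      apply Complex.ofReal_injective
      simp only [eq_ratCast] at hE
      rw [Complex.ofReal_ratCast, hE, Complex.ofReal_sum]
      refine Finset.sum_congr rfl fun σ _ => ?_
      push_cast
      rw [← hre, ← hre, map_mul, map_mul, map_pow]
      ring
    rw [← hE']
    exact_mod_cast h
  obtain ⟨k, hk⟩ := pow_unbounded_of_one_lt ((∑ σ : F →ₐ[ℚ] ℂ, |(σ p).re|) / (-τ p))
    (one_lt_pow₀ h1 two_ne_zero)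
  rw [div_lt_iff₀ (neg_pos.2 hneg), sq_abs] at hk
  have hk' := key k
  rw [← Finset.add_sum_erase _ _ (Finset.mem_univ σ₀), hσ₀, hσ₀, Complex.ofReal_re,
    Complex.ofReal_re] at hk'
  have hb : ∑ σ ∈ Finset.univ.erase σ₀, (σ p).re * ((σ a).re ^ 2) ^ k ≤
      ∑ σ : F →ₐ[ℚ] ℂ, |(σ p).re| := by
    refine (Finset.sum_le_sum fun σ hσ => ?_).trans
      (Finset.sum_le_sum_of_subset_of_nonneg (Finset.erase_subset σ₀ _) fun _ _ _ => abs_nonneg _)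
    have h3 : ((σ a).re ^ 2) ^ k ≤ 1 := by
      refine pow_le_one₀ (sq_nonneg _) ?_
      rw [← sq_abs]
      exact pow_le_one₀ (abs_nonneg _) (h2 σ (Finset.ne_of_mem_erase hσ)).le
    calc (σ p).re * ((σ a).re ^ 2) ^ k ≤ |(σ p).re| * ((σ a).re ^ 2) ^ k :=
          mul_le_mul_of_nonneg_right (le_abs_self _) (by positivity)
      _ ≤ |(σ p).re| := mul_le_of_le_one_right (abs_nonneg _) h3
  linarith

/-- Nondegeneracy of bilinear forms is preserved by field extensions. -/
theorem LinearMap.BilinForm.Nondegenerate.baseChange_field {K : Type*} (L : Type*) {V : Type*}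
    [Field K] [Field L] [Algebra K L] [AddCommGroup V] [Module K V] [FiniteDimensional K V]
    {B : LinearMap.BilinForm K V} (hB : B.Nondegenerate) : (B.baseChange L).Nondegenerate := by
  classical
  let b := Module.finBasis K V
  rw [LinearMap.BilinForm.nondegenerate_iff_det_ne_zero (b.baseChange L)]
  have h : LinearMap.BilinForm.toMatrix (b.baseChange L) (B.baseChange L) =
      (algebraMap K L).mapMatrix (LinearMap.BilinForm.toMatrix b B) := by
    ext i j
    simp [LinearMap.BilinForm.toMatrix_apply, Algebra.smul_def]
  rw [h, ← RingHom.map_det]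
  exact (map_ne_zero _).2 ((LinearMap.BilinForm.nondegenerate_iff_det_ne_zero b).1 hB)

/-- A positive definite symmetric `ℚ`-bilinear form, for which a number field `F` acts by
self-adjoint operators on a plane, is diagonal with respect to some `F`-basis: it is the trace of
a diagonal `F`-bilinear form. -/
theorem exists_basis_eq_trace {F : Type*} [Field F] [NumberField F]
    {V : Type*} [AddCommGroup V] [Module ℚ V] [Module F V] [IsScalarTower ℚ F V]
    [FiniteDimensional F V] (hdimV : Module.finrank F V = 2)
    {B : LinearMap.BilinForm ℚ V}
    (hsymm : ∀ x y : V, B x y = B y x)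
    (hpos : ∀ x : V, x ≠ 0 → 0 < B x x)
    (hcompat : ∀ (a : F) (x y : V), B (a • x) y = B x (a • y)) :
    ∃ (b : Module.Basis (Fin 2) F V) (p q : F), ∀ v w, B v w =
      Algebra.trace ℚ F (p * b.coord 0 v * b.coord 0 w + q * b.coord 1 v * b.coord 1 w) := by
  have hrep (e f : V) : ∃ r : F, ∀ a : F, B (a • e) f = Algebra.trace ℚ F (r * a) :=
    exists_forall_eq_trace_mul F
      ((B.flip f) ∘ₗ ((LinearMap.toSpanSingleton F V e).restrictScalars ℚ))
  let c := Module.finBasisOfFinrankEq F V hdimV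
  obtain ⟨p, hp⟩ := hrep (c 0) (c 0)
  obtain ⟨r, hr⟩ := hrep (c 0) (c 1)
  have hp0 : p ≠ 0 := by
    rintro rfl
    have h := hp 1
    rw [one_smul, zero_mul, (Algebra.trace ℚ F).map_zero] at h
    exact (hpos _ (c.ne_zero 0)).ne' h
  set e := c 0
  set f := c 1 - (r / p) • c 0 with hf
  have horth (a : F) : B (a • e) f = 0 := by
    rw [hf, map_sub, hr, ← hcompat, smul_smul, hp, ← map_sub]
    have : r * a - p * (r / p * a) = 0 := by field_simp; ring
    rw [this, map_zero]
  have hli : LinearIndependent F ![e, f] := by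
    have hc : LinearIndependent F ![c 0, c 1] := by
      convert c.linearIndependent using 1
      ext i; fin_cases i <;> rfl
    rw [LinearIndependent.pair_iff] at hc ⊢
    intro s t hst
    have := hc (s - t * (r / p)) t (by rw [← hst, hf]; module)
    obtain ⟨h1, rfl⟩ := this
    exact ⟨by simpa using h1, rfl⟩
  obtain ⟨q, hq⟩ := hrep f f
  let b := basisOfLinearIndependentOfCardEqFinrank hli (by simp [hdimV])
  refine ⟨b, p, q, fun v w => ?_⟩
  have hb (v : V) : v = b.coord 0 v • e + b.coord 1 v • f := by
    conv_lhs => rw [← b.sum_repr v]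
    simp [Fin.sum_univ_two, b]
  conv_lhs => rw [hb v, hb w]
  generalize b.coord 0 v = x, b.coord 1 v = y, b.coord 0 w = x', b.coord 1 w = y'
  have h1 : B (x • e) (x' • e) = Algebra.trace ℚ F (p * x * x') := by
    rw [← hcompat, smul_smul, hp]
    ring_nf
  have h2 : B (y • f) (y' • f) = Algebra.trace ℚ F (q * y * y') := by
    rw [← hcompat, smul_smul, hq]
    ring_nf
  have h3 : B (x • e) (y' • f) = 0 := by rw [← hcompat, smul_smul, horth]
  have h4 : B (y • f) (x' • e) = 0 := by rw [hsymm, ← hcompat, smul_smul, horth]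
  rw [map_add, map_add, LinearMap.add_apply, LinearMap.add_apply, h1, h2, h3, h4, map_add]
  ring

/-- A Hodge structure of type `(n,0,n)` with endomorphisms by a totally real
field `F` of degree `n` has an extra skew endomorphism `φ` with `φ² = -d` for a totally
positive `d ∈ F` (so it acquires CM by `F(√-d)`). -/
theorem totally_real_degree_n_extra_endomorphism
    (F : Type*) [Field F] [NumberField F] (n : ℕ)
    (htr : ∀ (ρ : F →+* ℂ) (a : F), (ρ a).im = 0)
    (hdegF : Module.finrank ℚ F = n)
    (V : Type*) [AddCommGroup V] [Module ℚ V] [Module F V] [IsScalarTower ℚ F V]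
    [FiniteDimensional F V] (hdimV : Module.finrank F V = 2)
    (B : LinearMap.BilinForm ℚ V)
    (hsymm : ∀ x y : V, B x y = B y x)
    (hpos : ∀ x : V, x ≠ 0 → 0 < B x x)
    (hcompat : ∀ (a : F) (x y : V), B (a • x) y = B x (a • y))
    (W : Submodule ℂ (ℂ ⊗[ℚ] V))
    (hWdim : Module.finrank ℂ W = n)
    (hisot : ∀ x ∈ W, ∀ y ∈ W, B.baseChange ℂ x y = 0)
    (hstable : ∀ (a : F), ∀ w ∈ W, actionC F V a w ∈ W) :
    ∃ (φ : V →ₗ[F] V) (d : F),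
      (∀ τ : F →+* ℝ, 0 < τ d) ∧
      (∀ x : V, φ (φ x) = -(d • x)) ∧
      (∀ x y : V, B (φ x) y = -B x (φ y)) ∧
      (∀ w ∈ W, (φ.restrictScalars ℚ).baseChange ℂ w ∈ W) := by
  obtain ⟨b, p, q, hB⟩ := exists_basis_eq_trace hdimV hsymm hpos hcompat
  have hb01 : b.coord 0 (b 1) = 0 := by simp
  have hb10 : b.coord 1 (b 0) = 0 := by simp
  have hb00 : b.coord 0 (b 0) = 1 := by simp
  have hb11 : b.coord 1 (b 1) = 1 := by simp
  have hp (τ : F →+* ℝ) : 0 < τ p := by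
    refine map_pos_of_forall_trace_pos htr (fun a ha => ?_) τ
    have h := hpos (a • b 0) (smul_ne_zero ha (b.ne_zero 0))
    rw [hB] at h
    simpa [map_smul, hb00, hb10] using h
  have hq (τ : F →+* ℝ) : 0 < τ q := by
    refine map_pos_of_forall_trace_pos htr (fun a ha => ?_) τ
    have h := hpos (a • b 1) (smul_ne_zero ha (b.ne_zero 1))
    rw [hB] at h
    simpa [map_smul, hb11, hb01] using h
  have hp0 : p ≠ 0 := by
    rintro rfl
    have h := hpos (b 0) (b.ne_zero 0)
    rw [hB, hb10] at h
    simp at h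
  have hq0 : q ≠ 0 := by
    rintro rfl
    have h := hpos (b 1) (b.ne_zero 1)
    rw [hB, hb01] at h
    simp at h
  set x := b.coord 0
  set y := b.coord 1
  let φ : V →ₗ[F] V := x.smulRight (p • b 1) - y.smulRight (q • b 0)
  have hφ (v : V) : φ v = x v • p • b 1 - y v • q • b 0 := rfl
  have hxφ (v : V) : x (φ v) = -(q * y v) := by
    simp only [hφ, map_sub, map_smul, hb01, hb00, smul_eq_mul]
    ring
  have hyφ (v : V) : y (φ v) = p * x v := by
    simp only [hφ, map_sub, map_smul, hb11, hb10, smul_eq_mul]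
    ring
  have hV (v : V) : v = x v • b 0 + y v • b 1 := by
    have h := b.sum_repr v
    rw [Fin.sum_univ_two] at h
    exact h.symm
  refine ⟨φ, p * q, fun τ => by rw [map_mul]; exact mul_pos (hp τ) (hq τ), fun v => ?_,
    fun v w => ?_, fun w hw => ?_⟩
  · rw [hφ, hxφ, hyφ]
    conv_rhs => rw [hV v]
    module
  · rw [hB, hB, ← map_neg, hxφ, hyφ, hxφ, hyφ]
    congr 1
    ring
  let X (σ : F →ₐ[ℚ] ℂ) : ℂ ⊗[ℚ] V →ₗ[ℂ] ℂ :=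
    (σ.toLinearMap ∘ₗ x.restrictScalars ℚ).liftBaseChange ℂ
  let Y (σ : F →ₐ[ℚ] ℂ) : ℂ ⊗[ℚ] V →ₗ[ℂ] ℂ :=
    (σ.toLinearMap ∘ₗ y.restrictScalars ℚ).liftBaseChange ℂ
  have hX (σ) (c : ℂ) (v : V) : X σ (c ⊗ₜ v) = c * σ (x v) := by simp [X]
  have hY (σ) (c : ℂ) (v : V) : Y σ (c ⊗ₜ v) = c * σ (y v) := by simp [Y]
  have hBC (v w : ℂ ⊗[ℚ] V) : B.baseChange ℂ v w =
      ∑ σ : F →ₐ[ℚ] ℂ, (σ p * X σ v * X σ w + σ q * Y σ v * Y σ w) := by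
    induction v with
    | zero => simp
    | add v v' hv hv' =>
      rw [map_add, LinearMap.add_apply, hv, hv', ← Finset.sum_add_distrib]
      refine Finset.sum_congr rfl fun σ _ => ?_
      rw [map_add, map_add]
      ring
    | tmul c v =>
      induction w with
      | zero => simp
      | add w w' hw hw' =>
        rw [map_add, hw, hw', ← Finset.sum_add_distrib]
        refine Finset.sum_congr rfl fun σ _ => ?_
        rw [map_add, map_add]
        ring
      | tmul c' w =>
        rw [LinearMap.BilinForm.baseChange_tmul, hB, Algebra.smul_def,
          trace_eq_sum_embeddings ℂ, Finset.sum_mul]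
        refine Finset.sum_congr rfl fun σ _ => ?_
        simp only [hX, hY, map_add, map_mul]
        ring
  have hXa (σ) (a : F) (v : ℂ ⊗[ℚ] V) : X σ (actionC F V a v) = σ a * X σ v := by
    induction v with
    | zero => simp
    | add v v' hv hv' => rw [map_add, map_add, map_add, hv, hv', mul_add]
    | tmul c v =>
      simp only [actionC, LinearMap.baseChange_tmul, hX, LinearMap.restrictScalars_apply,
        LinearMap.lsmul_apply, map_smul, smul_eq_mul, map_mul]
      ring
  have hYa (σ) (a : F) (v : ℂ ⊗[ℚ] V) : Y σ (actionC F V a v) = σ a * Y σ v := by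
    induction v with
    | zero => simp
    | add v v' hv hv' => rw [map_add, map_add, map_add, hv, hv', mul_add]
    | tmul c v =>
      simp only [actionC, LinearMap.baseChange_tmul, hY, LinearMap.restrictScalars_apply,
        LinearMap.lsmul_apply, map_smul, smul_eq_mul, map_mul]
      ring
  have hXφ (σ) (v : ℂ ⊗[ℚ] V) :
      X σ ((φ.restrictScalars ℚ).baseChange ℂ v) = -(σ q * Y σ v) := by
    induction v with
    | zero => simp
    | add v v' hv hv' => rw [map_add, map_add, map_add, hv, hv']; ring
    | tmul c v =>
      simp only [LinearMap.baseChange_tmul, hX, hY, LinearMap.restrictScalars_apply, hxφ,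
        map_mul, map_neg]
      ring
  have hYφ (σ) (v : ℂ ⊗[ℚ] V) :
      Y σ ((φ.restrictScalars ℚ).baseChange ℂ v) = σ p * X σ v := by
    induction v with
    | zero => simp
    | add v v' hv hv' => rw [map_add, map_add, map_add, hv, hv']; ring
    | tmul c v =>
      simp only [LinearMap.baseChange_tmul, hX, hY, LinearMap.restrictScalars_apply, hyφ,
        map_mul]
      ring
  have hli : LinearIndependent ℂ (fun (σ : F →ₐ[ℚ] ℂ) (a : F) => σ a) :=
    (linearIndependent_monoidHom F ℂ).comp (fun σ : F →ₐ[ℚ] ℂ => (σ : F →* ℂ))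
      fun σ σ' h => by
        ext a
        exact DFunLike.congr_fun h a
  have hloc (σ : F →ₐ[ℚ] ℂ) {v w : ℂ ⊗[ℚ] V} (hv : v ∈ W) (hw : w ∈ W) :
      σ p * X σ v * X σ w + σ q * Y σ v * Y σ w = 0 := by
    refine Fintype.linearIndependent_iff.1 hli
      (fun σ => σ p * X σ v * X σ w + σ q * Y σ v * Y σ w) (funext fun a => ?_) σ
    have h := hisot _ (hstable a v hv) _ hw
    rw [hBC] at h
    simp only [Finset.sum_apply, Pi.smul_apply, smul_eq_mul, Pi.zero_apply]
    rw [← h]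
    refine Finset.sum_congr rfl fun σ _ => ?_
    rw [hXa, hYa]
    ring
  have : FiniteDimensional ℚ V := Module.Finite.trans F V
  have hnd : B.Nondegenerate :=
    ⟨fun v hv => by_contra fun h => (hpos v h).ne' (hv v),
      fun v hv => by_contra fun h => (hpos v h).ne' (hv v)⟩
  have hW : W = (B.baseChange ℂ).orthogonal W := by
    refine Submodule.eq_of_le_of_finrank_eq (fun v hv w hw => hisot w hw v hv) ?_
    rw [LinearMap.BilinForm.finrank_orthogonal (hnd.baseChange_field ℂ), Module.finrank_baseChange,
      ← Module.finrank_mul_finrank ℚ F V, hdimV, hdegF, hWdim]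
    omega
  rw [hW]
  intro v hv
  change B.baseChange ℂ v _ = 0
  rw [hBC]
  refine Finset.sum_eq_zero fun σ _ => ?_
  rw [hXφ, hYφ]
  have hσp : σ p ≠ 0 := (map_ne_zero σ).2 hp0
  have hσq : σ q ≠ 0 := (map_ne_zero σ).2 hq0
  have hdet : X σ w * Y σ v - X σ v * Y σ w = 0 := by
    have h : σ p * σ q * (X σ w * Y σ v - X σ v * Y σ w) ^ 2 = 0 := by
      linear_combination (σ p * X σ v * X σ v + σ q * Y σ v * Y σ v) * hloc σ hw hw -
        (σ p * X σ v * X σ w + σ q * Y σ v * Y σ w) * hloc σ hv hw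
    simpa [hσp, hσq] using h
  linear_combination σ p * σ q * hdet
end

section
/- Let V be a 2-dimensional ℚ-vector space with a symmetric positive definite ℚ-bilinear form B, and let W ⊆ V_ℂ be a 1-dimensional ℂ-subspace that is isotropic for B_ℂ. Then there exist a ℚ-linear map φ : V → V and a rational number d > 0 such that φ∘φ = −d·id_V, B(φ(x), y) = −B(x, φ(y)) for all x, y ∈ V, and (φ ⊗ id_ℂ)(W) ⊆ W. -/
open TensorProduct

/-- Every vector of the base change of a plane is a combination of the vectors of a basis. -/
theorem exists_tmul_add_tmul {K L V : Type*} [Field K] [Field L] [Algebra K L] [AddCommGroup V]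
    [Module K V] (e : Module.Basis (Fin 2) K V) (w : L ⊗[K] V) :
    ∃ p q : L, w = p ⊗ₜ[K] e 0 + q ⊗ₜ[K] e 1 := by
  refine ⟨(e.baseChange L).repr w 0, (e.baseChange L).repr w 1, ?_⟩
  conv_lhs => rw [← (e.baseChange L).sum_repr w]
  simp [Fin.sum_univ_two, TensorProduct.smul_tmul']

/-- Every ℚ-Hodge structure of type `(1,0,1)` has an extra skew
endomorphism `φ` with `φ² = -d·id` for some rational `d > 0` (so it has CM by the
imaginary quadratic field `ℚ(√-d)`). -/
theorem type_one_zero_one_has_cm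
    (V : Type*) [AddCommGroup V] [Module ℚ V] [FiniteDimensional ℚ V]
    (hdim : Module.finrank ℚ V = 2)
    (B : LinearMap.BilinForm ℚ V)
    (hsymm : ∀ x y : V, B x y = B y x)
    (hpos : ∀ x : V, x ≠ 0 → 0 < B x x)
    (W : Submodule ℂ (ℂ ⊗[ℚ] V))
    (hWdim : Module.finrank ℂ W = 1)
    (hisot : ∀ x ∈ W, ∀ y ∈ W, B.baseChange ℂ x y = 0) :
    ∃ (φ : V →ₗ[ℚ] V) (d : ℚ),
      0 < d ∧
      (∀ x : V, φ (φ x) = -(d • x)) ∧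
      (∀ x y : V, B (φ x) y = -B x (φ y)) ∧
      (∀ w ∈ W, φ.baseChange ℂ w ∈ W) := by
  let e := Module.finBasisOfFinrankEq ℚ V hdim
  obtain ⟨a, ha⟩ : ∃ a, B (e 0) (e 0) = a := ⟨_, rfl⟩
  obtain ⟨b, hb⟩ : ∃ b, B (e 0) (e 1) = b := ⟨_, rfl⟩
  obtain ⟨c, hc⟩ : ∃ c, B (e 1) (e 1) = c := ⟨_, rfl⟩
  have hb' : B (e 1) (e 0) = b := by rw [hsymm, hb]
  have hc_pos : 0 < c := hc ▸ hpos _ (e.ne_zero 1)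
  have hdisc : 0 < a * c - b ^ 2 := by
    have hne : c • e 0 + (-b) • e 1 ≠ 0 := fun h => by
      have := congrArg (fun v => e.repr v 0) h
      simp at this
      exact hc_pos.ne' this
    have h := hpos _ hne
    simp only [map_add, map_smul, LinearMap.add_apply, LinearMap.smul_apply, smul_eq_mul,
      ha, hb, hb', hc] at h
    exact pos_of_mul_pos_right (a := c) (by linarith) hc_pos.le
  let φ : V →ₗ[ℚ] V := e.constr ℚ ![(-b) • e 0 + a • e 1, (-c) • e 0 + b • e 1]
  have h0 : φ (e 0) = (-b) • e 0 + a • e 1 := by simp [φ]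
  have h1 : φ (e 1) = (-c) • e 0 + b • e 1 := by simp [φ]
  have hspan (x : V) : ∃ s t : ℚ, x = s • e 0 + t • e 1 :=
    ⟨e.repr x 0, e.repr x 1, by rw [← Fin.sum_univ_two fun i => e.repr x i • e i, e.sum_repr]⟩
  refine ⟨φ, a * c - b ^ 2, hdisc, fun x => ?_, fun x y => ?_, fun w hw => ?_⟩
  · obtain ⟨s, t, rfl⟩ := hspan x
    simp only [map_add, map_smul, h0, h1]
    module
  · obtain ⟨s, t, rfl⟩ := hspan x
    obtain ⟨u, v, rfl⟩ := hspan y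
    simp only [map_add, map_smul, h0, h1, LinearMap.add_apply, LinearMap.smul_apply, smul_eq_mul,
      ha, hb, hb', hc]
    ring
  · obtain ⟨p, q, rfl⟩ := exists_tmul_add_tmul e w
    have hq := hisot _ hw _ hw
    simp only [map_add, LinearMap.add_apply, LinearMap.BilinForm.baseChange_tmul, ha, hb, hb', hc,
      Algebra.smul_def, eq_ratCast] at hq
    by_cases hp : p = 0
    · subst hp
      have : q = 0 := by simpa [hc_pos.ne'] using hq
      simp [this]
    · have key : φ.baseChange ℂ (p ⊗ₜ[ℚ] e 0 + q ⊗ₜ[ℚ] e 1)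
          = ((-b * p - c * q) / p) • (p ⊗ₜ[ℚ] e 0 + q ⊗ₜ[ℚ] e 1) := by
        have hl : (-b * p - c * q) / p * p = (-b) • p + (-c) • q := by
          simp only [Rat.smul_def, Rat.cast_neg]
          field_simp
          ring
        have hr : (-b * p - c * q) / p * q = a • p + b • q := by
          simp only [Rat.smul_def]
          field_simp
          linear_combination -hq
        simp only [map_add, LinearMap.baseChange_tmul, h0, h1, smul_add, TensorProduct.smul_tmul',
          smul_eq_mul, hl, hr, TensorProduct.tmul_add, TensorProduct.add_tmul,
          TensorProduct.tmul_smul]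
        abel
      rw [key]
      exact W.smul_mem _ hw
end
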